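/- arXiv:1401.0609 — 3 statements merged into one kernel-verified Lean document; each statement's English description precedes it below -/
import Mathlib

section
/- Let q and r be linearly independent unit vectors in ℝ^m and let V x = x − ⟨x,q⟩(q − r) − ⟨x, r_{⊥q}⟩ · (1/(1 − ⟨q,r⟩)) · (r − q), where r_{⊥q} = r − ⟨q,r⟩q. For x ∈ ℝ^m set y = x − ⟨x,q⟩q (the orthogonal projection of x parallel to q) and x' = V x. Then: (i) ⟨x', r⟩ = ⟨x, q⟩; and (ii) V y = y − ⟨y, r⟩ · (1/(1 − ⟨q,r⟩)) · (r − q) = x' − ⟨x', r⟩ r, i.e., the image of y under V is the orthogonal projection of x' parallel to r. -/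
open scoped RealInnerProductSpace

/-- For linearly independent unit vectors `q, r` in `ℝ^m`, let
`V x = x − ⟨x,q⟩(q − r) − ⟨x, r⊥q⟩ (1/(1 − ⟨q,r⟩)) (r − q)` with `r⊥q = r − ⟨q,r⟩q`.
For `x ∈ ℝ^m`, set `y = x − ⟨x,q⟩q` and `x' = V x`. Then (i) `⟨x', r⟩ = ⟨x, q⟩`, and
(ii) `V y = y − ⟨y,r⟩ (1/(1 − ⟨q,r⟩)) (r − q) = x' − ⟨x', r⟩ r`. -/
theorem V_projects_Y_to_Z {m : ℕ} (hm : 2 ≤ m)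
    (q r : EuclideanSpace ℝ (Fin m)) (hq : ‖q‖ = 1) (hr : ‖r‖ = 1)
    (hind : LinearIndependent ℝ ![q, r])
    (rpq : EuclideanSpace ℝ (Fin m)) (hrpq : rpq = r - ⟪q, r⟫ • q)
    (V : EuclideanSpace ℝ (Fin m) → EuclideanSpace ℝ (Fin m))
    (hV : ∀ x, V x = x - ⟪x, q⟫ • (q - r)
        - (⟪x, rpq⟫ * (1 / (1 - ⟪q, r⟫))) • (r - q))
    (x y x' : EuclideanSpace ℝ (Fin m))
    (hy : y = x - ⟪x, q⟫ • q) (hx' : x' = V x) :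
    ⟪x', r⟫ = ⟪x, q⟫ ∧
      V y = y - (⟪y, r⟫ * (1 / (1 - ⟪q, r⟫))) • (r - q) ∧
      V y = x' - ⟪x', r⟫ • r := by
  have hc : 1 - ⟪q, r⟫ ≠ 0 := by
    intro h
    have hqr : q = r := (inner_eq_one_iff_of_norm_eq_one (𝕜 := ℝ) hq hr).mp (sub_eq_zero.mp h).symm
    have h01 : (0 : Fin 2) = 1 := hind.injective (by simpa using hqr)
    exact absurd h01 (by decide)
  have hqq : ⟪q, q⟫ = 1 := by simp [hq]
  have hrr : ⟪r, r⟫ = 1 := by simp [hr]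
  have hyq : ⟪y, q⟫ = 0 := by
    rw [hy, inner_sub_left, real_inner_smul_left, hqq]; ring
  have hyp : ⟪y, rpq⟫ = ⟪y, r⟫ := by
    rw [hrpq, inner_sub_right, real_inner_smul_right, hyq]; ring
  have hxp : ⟪x, rpq⟫ = ⟪y, r⟫ := by
    rw [hrpq, hy, inner_sub_right, inner_sub_left, real_inner_smul_right,
      real_inner_smul_left]; ring
  have hyr : ⟪y, r⟫ = ⟪x, r⟫ - ⟪x, q⟫ * ⟪q, r⟫ := by
    rw [hy, inner_sub_left, real_inner_smul_left]
  have hx'r : ⟪x', r⟫ = ⟪x, q⟫ := by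
    rw [hx', hV, hxp, hyr]
    simp only [inner_sub_left, real_inner_smul_left, hrr]
    field_simp
    ring
  have hVy : V y = y - (⟪y, r⟫ * (1 / (1 - ⟪q, r⟫))) • (r - q) := by
    rw [hV, hyq, hyp, zero_smul, sub_zero]
  refine ⟨hx'r, hVy, ?_⟩
  rw [hVy, hx'r, hx', hV, hxp]
  nth_rewrite 1 [hy]
  module
end

section
/- Let q, q̂, a₃, a₄ and r, r̂, b₃, b₄ be two orthonormal bases of the same four-dimensional subspace L̂ of ℝ^m and define S(ŷ) = ŷ − ⟨ŷ, a₃⟩(a₃ − b₃) − ⟨ŷ, a₄⟩(a₄ − b₄). Then S, restricted to the subspace {q, q̂}^⊥ = {ŷ : ⟨ŷ,q⟩ = ⟨ŷ,q̂⟩ = 0}, is a linear isometry from {q, q̂}^⊥ onto {r, r̂}^⊥ = {z : ⟨z,r⟩ = ⟨z,r̂⟩ = 0}; in particular the transformation ŷ ↦ S(ŷ) is one-to-one from {q, q̂}^⊥ onto {r, r̂}^⊥. -/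
open scoped RealInnerProductSpace

/-- Exchanging the components of `y ∈ {q, q'}^⊥` along `a, a'` for the same components along
`b, b'` lands in `{r, r'}^⊥` and preserves both these components and the norm. -/
theorem Orthonormal.exchange_properties {E : Type*} [NormedAddCommGroup E] [InnerProductSpace ℝ E]
    {q q' a a' r r' b b' : E} (h₁ : Orthonormal ℝ ![q, q', a, a'])
    (h₂ : Orthonormal ℝ ![r, r', b, b'])
    (hspan : Submodule.span ℝ {r, r', b, b'} ≤ Submodule.span ℝ {q, q', a, a'})
    {y z : E} (hq : ⟪y, q⟫ = 0) (hq' : ⟪y, q'⟫ = 0)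
    (hz : z = y - ⟪y, a⟫ • (a - b) - ⟪y, a'⟫ • (a' - b')) :
    (⟪z, r⟫ = 0 ∧ ⟪z, r'⟫ = 0) ∧ ⟪z, b⟫ = ⟪y, a⟫ ∧ ⟪z, b'⟫ = ⟪y, a'⟫ ∧ ‖z‖ = ‖y‖ := by
  rw [orthonormal_iff_ite] at h₁ h₂
  have haq : ⟪a, q⟫ = 0 := by simpa using h₁ 2 0
  have haq' : ⟪a, q'⟫ = 0 := by simpa using h₁ 2 1
  have ha'q : ⟪a', q⟫ = 0 := by simpa using h₁ 3 0
  have ha'q' : ⟪a', q'⟫ = 0 := by simpa using h₁ 3 1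
  have haa : ⟪a, a⟫ = 1 := by simpa using h₁ 2 2
  have haa' : ⟪a, a'⟫ = 0 := by simpa using h₁ 2 3
  have ha'a : ⟪a', a⟫ = 0 := by simpa using h₁ 3 2
  have ha'a' : ⟪a', a'⟫ = 1 := by simpa using h₁ 3 3
  have hbr : ⟪b, r⟫ = 0 := by simpa using h₂ 2 0
  have hbr' : ⟪b, r'⟫ = 0 := by simpa using h₂ 2 1
  have hb'r : ⟪b', r⟫ = 0 := by simpa using h₂ 3 0
  have hb'r' : ⟪b', r'⟫ = 0 := by simpa using h₂ 3 1
  have hbb : ⟪b, b⟫ = 1 := by simpa using h₂ 2 2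
  have hbb' : ⟪b, b'⟫ = 0 := by simpa using h₂ 2 3
  have hb'b : ⟪b', b⟫ = 0 := by simpa using h₂ 3 2
  have hb'b' : ⟪b', b'⟫ = 1 := by simpa using h₂ 3 3
  obtain ⟨w, hw⟩ : ∃ w, w = y - ⟪y, a⟫ • a - ⟪y, a'⟫ • a' := ⟨_, rfl⟩
  have hwL : ∀ x ∈ Submodule.span ℝ {q, q', a, a'}, ⟪w, x⟫ = 0 := by
    intro x hx
    have hle : Submodule.span ℝ {q, q', a, a'} ≤ LinearMap.ker (innerₛₗ ℝ w) := by
      rw [Submodule.span_le]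
      rintro x (rfl | rfl | rfl | rfl) <;>
        simp [hw, inner_sub_left, real_inner_smul_left, *, -inner_self_eq_norm_sq_to_K]
    simpa using hle hx
  have hwa : ⟪w, a⟫ = 0 := hwL a (Submodule.subset_span (by simp))
  have hwa' : ⟪w, a'⟫ = 0 := hwL a' (Submodule.subset_span (by simp))
  have hwr : ⟪w, r⟫ = 0 := hwL r (hspan (Submodule.subset_span (by simp)))
  have hwr' : ⟪w, r'⟫ = 0 := hwL r' (hspan (Submodule.subset_span (by simp)))
  have hwb : ⟪w, b⟫ = 0 := hwL b (hspan (Submodule.subset_span (by simp)))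
  have hwb' : ⟪w, b'⟫ = 0 := hwL b' (hspan (Submodule.subset_span (by simp)))
  have hnorm : ∀ {u v : E} (c d : ℝ), ⟪u, u⟫ = 1 → ⟪v, v⟫ = 1 → ⟪u, v⟫ = 0 → ⟪w, u⟫ = 0 →
      ⟪w, v⟫ = 0 → ‖w + c • u + d • v‖ ^ 2 = ‖w‖ ^ 2 + c ^ 2 + d ^ 2 := by
    intro u v c d huu hvv huv hwu hwv
    have hvu : ⟪v, u⟫ = 0 := by rw [real_inner_comm, huv]
    have huw : ⟪u, w⟫ = 0 := by rw [real_inner_comm, hwu]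
    have hvw : ⟪v, w⟫ = 0 := by rw [real_inner_comm, hwv]
    simp only [← real_inner_self_eq_norm_sq, inner_add_left, inner_add_right,
      real_inner_smul_left, real_inner_smul_right, huu, hvv, huv, hwu, hwv, hvu, huw, hvw]
    ring
  have hzw : z = w + ⟪y, a⟫ • b + ⟪y, a'⟫ • b' := by rw [hz, hw]; module
  have hyw : y = w + ⟪y, a⟫ • a + ⟪y, a'⟫ • a' := by rw [hw]; module
  have hzn := hnorm ⟪y, a⟫ ⟪y, a'⟫ hbb hb'b' hbb' hwb hwb'
  have hyn := hnorm ⟪y, a⟫ ⟪y, a'⟫ haa ha'a' haa' hwa hwa'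
  rw [← hzw] at hzn
  rw [← hyw] at hyn
  refine ⟨⟨?_, ?_⟩, ?_, ?_, ?_⟩
  · simp [hzw, inner_add_left, real_inner_smul_left, hwr, hbr, hb'r]
  · simp [hzw, inner_add_left, real_inner_smul_left, hwr', hbr', hb'r']
  · simp [hzw, inner_add_left, real_inner_smul_left, hwb, hbb, hb'b, -inner_self_eq_norm_sq_to_K]
  · simp [hzw, inner_add_left, real_inner_smul_left, hwb', hbb', hb'b', -inner_self_eq_norm_sq_to_K]
  · exact (sq_eq_sq₀ (norm_nonneg z) (norm_nonneg y)).1 (hzn.trans hyn.symm)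

/-- Let `q, q̂, a₃, a₄` and `r, r̂, b₃, b₄` be two orthonormal
bases of the same four-dimensional subspace `L̂` of `ℝ^m`, and define
`S ŷ = ŷ − ⟨ŷ,a₃⟩(a₃ − b₃) − ⟨ŷ,a₄⟩(a₄ − b₄)`. Then `S` restricted to
`{q,q̂}^⊥ = {ŷ : ⟨ŷ,q⟩ = ⟨ŷ,q̂⟩ = 0}` is a linear isometry from `{q,q̂}^⊥` onto
`{r,r̂}^⊥`; in particular `ŷ ↦ S ŷ` is one-to-one from `{q,q̂}^⊥` onto `{r,r̂}^⊥`. -/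
theorem S_isometry_on_orthocomplement {m : ℕ} (hm : 4 ≤ m)
    (q qh a₃ a₄ r rh b₃ b₄ : EuclideanSpace ℝ (Fin m))
    (hON1 : Orthonormal ℝ ![q, qh, a₃, a₄])
    (hON2 : Orthonormal ℝ ![r, rh, b₃, b₄])
    (Lhat : Submodule ℝ (EuclideanSpace ℝ (Fin m)))
    (hLhat1 : Lhat = Submodule.span ℝ ({q, qh, a₃, a₄} : Set (EuclideanSpace ℝ (Fin m))))
    (hLhat2 : Lhat = Submodule.span ℝ ({r, rh, b₃, b₄} : Set (EuclideanSpace ℝ (Fin m))))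
    (S : EuclideanSpace ℝ (Fin m) → EuclideanSpace ℝ (Fin m))
    (hS : ∀ yh, S yh = yh - ⟪yh, a₃⟫ • (a₃ - b₃) - ⟪yh, a₄⟫ • (a₄ - b₄))
    (K K' : Set (EuclideanSpace ℝ (Fin m)))
    (hK : K = {y | ⟪y, q⟫ = 0 ∧ ⟪y, qh⟫ = 0})
    (hK' : K' = {z | ⟪z, r⟫ = 0 ∧ ⟪z, rh⟫ = 0}) :
    (∀ y₁ y₂ : EuclideanSpace ℝ (Fin m), ∀ a b : ℝ, y₁ ∈ K → y₂ ∈ K →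
        S (a • y₁ + b • y₂) = a • S y₁ + b • S y₂) ∧
    (∀ y ∈ K, ‖S y‖ = ‖y‖) ∧
    Set.BijOn S K K' := by
  have hspan := hLhat1.symm.trans hLhat2
  subst hK hK'
  have hfwd := fun y (hy : ⟪y, q⟫ = 0 ∧ ⟪y, qh⟫ = 0) =>
    hON1.exchange_properties hON2 hspan.ge hy.1 hy.2 (hS y)
  have hbwd := fun z (hz : ⟪z, r⟫ = 0 ∧ ⟪z, rh⟫ = 0) =>
    hON2.exchange_properties hON1 hspan.le hz.1 hz.2 rfl
  refine ⟨fun y₁ y₂ a b _ _ => ?_, fun y hy => (hfwd y hy).2.2.2, ?_⟩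
  · simp only [hS, inner_add_left, real_inner_smul_left]
    module
  · refine Set.InvOn.bijOn
      (f' := fun z => z - ⟪z, b₃⟫ • (b₃ - a₃) - ⟪z, b₄⟫ • (b₄ - a₄)) ⟨fun y hy => ?_, fun z hz => ?_⟩
      (fun y hy => (hfwd y hy).1) (fun z hz => (hbwd z hz).1)
    · obtain ⟨-, h₃, h₄, -⟩ := hfwd y hy
      simp only [h₃, h₄]
      rw [hS]
      module
    · obtain ⟨-, h₃, h₄, -⟩ := hbwd z hz
      rw [hS, h₃, h₄]
      module
end

section
/- Let q and r be linearly independent unit vectors in ℝ^m. Then the reflection U_{q,r} x = x − (2⟨r − q, x⟩/‖r − q‖²)(r − q) coincides with the operator I_{L*} + U of the unitary construction; that is, for every x ∈ ℝ^m, U_{q,r} x = x − ⟨x,q⟩(q − r) − ⟨x, r_{⊥q}⟩ · (1/(1 − ⟨q,r⟩)) · (r − q), where r_{⊥q} = r − ⟨q,r⟩q. -/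
open scoped RealInnerProductSpace

/-- For linearly independent unit vectors `q, r` in `ℝ^m`, the
reflection `U_{q,r} x = x − (2⟨r − q, x⟩/‖r − q‖²)(r − q)` coincides with the
operator `I_{L*} + U` of the unitary construction: for every `x`,
`U_{q,r} x = x − ⟨x,q⟩(q − r) − ⟨x, r⊥q⟩ (1/(1 − ⟨q,r⟩)) (r − q)`,
where `r⊥q = r − ⟨q,r⟩q`. -/
theorem reflection_eq_IL_plus_U {m : ℕ} (hm : 2 ≤ m)
    (q r : EuclideanSpace ℝ (Fin m)) (hq : ‖q‖ = 1) (hr : ‖r‖ = 1)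
    (hind : LinearIndependent ℝ ![q, r])
    (rpq : EuclideanSpace ℝ (Fin m)) (hrpq : rpq = r - ⟪q, r⟫ • q) :
    ∀ x : EuclideanSpace ℝ (Fin m),
      x - ((2 * ⟪r - q, x⟫) / ‖r - q‖ ^ 2) • (r - q)
        = x - ⟪x, q⟫ • (q - r) - (⟪x, rpq⟫ * (1 / (1 - ⟪q, r⟫))) • (r - q) := by
  intro x
  have hne : q ≠ r := fun h => zero_ne_one (hind.injective (a₁ := 0) (a₂ := 1) (by simpa using h))
  have hc : 1 - ⟪q, r⟫ ≠ 0 :=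
    sub_ne_zero.2 fun h => hne ((inner_eq_one_iff_of_norm_eq_one hq hr).1 h.symm)
  have hnorm : ‖r - q‖ ^ 2 = 2 * (1 - ⟪q, r⟫) := by
    rw [norm_sub_sq_real, hq, hr, real_inner_comm]
    ring
  have hcoeff : 2 * ⟪r - q, x⟫ / ‖r - q‖ ^ 2
      = ⟪x, rpq⟫ * (1 / (1 - ⟪q, r⟫)) - ⟪x, q⟫ := by
    rw [hnorm, hrpq, inner_sub_left, inner_sub_right, real_inner_smul_right,
      real_inner_comm x r, real_inner_comm x q]
    field_simp
    ring
  rw [hcoeff]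
  module
end
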